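/- Let E, F ∈ RegExp^∞(F,K) be regular infinite-tree expressions. If their hyper-path interpretations agree, 𝓣_K⟦E⟧ = 𝓣_K⟦F⟧, then for every Markov-algebra interpretation (M, ⟦·⟧) and every hole-valuation γ : K → M, their algebraic interpretations agree: M_γ⟦E⟧ = M_γ⟦F⟧. -/

import Mathlib

abbrev Pos := List ℕ

inductive Label (F : Type) (K : Type) where
  | sym (f : F)
  | var (k : K)
  | loop

def Label.arity {F K : Type} (ar : F → ℕ) : Label F K → ℕ
  | .sym f => ar f
  | .var _ => 0
  | .loop => 0

/-- A possibly-infinite tree, as a partial map from positions to labels. -/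
abbrev PTree (F K : Type) := Pos → Option (Label F K)

def IsTree {F K : Type} (ar : F → ℕ) (t : PTree F K) : Prop :=
  t [] ≠ none ∧
  (∀ (p : Pos) (j : ℕ), t (p ++ [j]) ≠ none → t p ≠ none) ∧
  (∀ (p : Pos) (l : Label F K), t p = some l →
    ∀ j : ℕ, (t (p ++ [j]) ≠ none ↔ 1 ≤ j ∧ j ≤ Label.arity ar l))

def subtree {F K : Type} (t : PTree F K) (p : Pos) : PTree F K := fun q => t (p ++ q)

def loopTree {F K : Type} : PTree F K := fun p => if p = [] then some Label.loop else none

/-- A relation `R` is compatible with the coinductive characterization of refinement. -/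
def RefineCompat {F K : Type} (ar : F → ℕ) (R : PTree F K → PTree F K → Prop) : Prop :=
  ∀ t₁ t₂, R t₁ t₂ →
    t₁ = loopTree ∨
    ∃ l : Label F K, l ≠ Label.loop ∧ t₁ [] = some l ∧ t₂ [] = some l ∧
      ∀ i : ℕ, 1 ≤ i → i ≤ Label.arity ar l → R (subtree t₁ [i]) (subtree t₂ [i])

/-- The refinement relation `⊑_T`: the largest relation compatible with the
coinductive characterization. -/
def Refine {F K : Type} (ar : F → ℕ) (t₁ t₂ : PTree F K) : Prop :=
  ∃ R, RefineCompat ar R ∧ R t₁ t₂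

/-- `s` is the supremum (w.r.t. `⊑_T`) of the ω-chain `c` of possibly-infinite trees. -/
def IsSupTree {F K : Type} (ar : F → ℕ) (c : ℕ → PTree F K) (s : PTree F K) : Prop :=
  (∀ i, Refine ar (c i) s) ∧ ∀ u, IsTree ar u → (∀ i, Refine ar (c i) u) → Refine ar s u

/- Substitution of the tree `u` for every occurrence of the hole variable `z` in `t`
(the coinductively defined substitution operator, given pointwise). -/
open Classical in
noncomputable def subst {F K : Type} (z : K) (t u : PTree F K) : PTree F K := fun p =>
  if h : ∃ q : Pos, q <+: p ∧ t q = some (Label.var z) then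
    u (p.drop h.choose.length)
  else t p

abbrev Prob : Type := Set.Icc (0 : ℝ) 1

/-- The program alphabet: ε, sequencing, conditional-, probabilistic-, and
nondeterministic-choice. -/
inductive PSym (A : Type) (L : Type) where
  | eps
  | seq (act : A)
  | cond (φ : L)
  | prob (p : Prob)
  | ndet

def PSym.arity {A L : Type} : PSym A L → ℕ
  | .eps => 0
  | .seq _ => 1
  | .cond _ => 2
  | .prob _ => 2
  | .ndet => 2

/-- A Markov algebra over logical conditions `L`: a dcpo with least element, a monoid
`⊗`, confluence operations `◃φ▹`, `⋄p`, `⌣` (all Scott-continuous), with `⌣` an upper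
semilattice operation dominating the other two confluences. -/
structure MarkovAlg (L : Type) (M : Type) [PartialOrder M] where
  bot : M
  one : M
  mul : M → M → M
  cond : L → M → M → M
  prob : Prob → M → M → M
  ndet : M → M → M
  bot_le : ∀ a, bot ≤ a
  dcpo : ∀ d : Set M, d.Nonempty → DirectedOn (· ≤ ·) d → ∃ s, IsLUB d s
  mul_assoc : ∀ a b c, mul (mul a b) c = mul a (mul b c)
  one_mul : ∀ a, mul one a = a
  mul_one : ∀ a, mul a one = a
  ndet_idem : ∀ a, ndet a a = a
  ndet_comm : ∀ a b, ndet a b = ndet b a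
  ndet_assoc : ∀ a b c, ndet (ndet a b) c = ndet a (ndet b c)
  cond_le_ndet : ∀ φ a b, ndet (cond φ a b) (ndet a b) = ndet a b
  prob_le_ndet : ∀ p a b, ndet (prob p a b) (ndet a b) = ndet a b
  mul_scott_left : ∀ a, ScottContinuous fun x => mul x a
  mul_scott_right : ∀ a, ScottContinuous (mul a)
  cond_scott_left : ∀ φ a, ScottContinuous fun x => cond φ x a
  cond_scott_right : ∀ φ a, ScottContinuous (cond φ a)
  prob_scott_left : ∀ p a, ScottContinuous fun x => prob p x a
  prob_scott_right : ∀ p a, ScottContinuous (prob p a)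
  ndet_scott_left : ∀ a, ScottContinuous fun x => ndet x a
  ndet_scott_right : ∀ a, ScottContinuous (ndet a)

/-- The approximating sequence of the coinductively defined tree interpretation
`r^M_γ` of possibly-infinite trees over the program alphabet, for the Markov-algebra
interpretation `(P, ia)` and hole-valuation `γ`. -/
def maSeq {A L K M : Type} [PartialOrder M] (P : MarkovAlg L M) (ia : A → M)
    (γ : K → M) : ℕ → PTree (PSym A L) K → M
  | 0, _ => P.bot
  | i + 1, t =>
    match t [] with
    | some (.sym .eps) => P.one
    | some (.sym (.seq act)) => P.mul (ia act) (maSeq P ia γ i (subtree t [1]))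
    | some (.sym (.cond φ)) =>
        P.cond φ (maSeq P ia γ i (subtree t [1])) (maSeq P ia γ i (subtree t [2]))
    | some (.sym (.prob p)) =>
        P.prob p (maSeq P ia γ i (subtree t [1])) (maSeq P ia γ i (subtree t [2]))
    | some (.sym .ndet) =>
        P.ndet (maSeq P ia γ i (subtree t [1])) (maSeq P ia γ i (subtree t [2]))
    | some (.var k) => γ k
    | _ => P.bot

/-- `r` is the coinductively defined Markov-algebra tree interpretation `r^M_γ`,
i.e. the pointwise supremum of the approximating sequence. -/
def IsTreeInterp {A L K M : Type} [PartialOrder M] (P : MarkovAlg L M) (ia : A → M)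
    (γ : K → M) (r : PTree (PSym A L) K → M) : Prop :=
  ∀ t, IsLUB (Set.range fun i => maSeq P ia γ i t) (r t)

/-- Regular infinite-tree expressions over the program alphabet, with concatenation
`E₁ ·_z E₂` and closure `E^{∞_z}`. -/
inductive RegExp (A : Type) (L : Type) (K : Type) where
  | eps
  | var (z : K)
  | seq (act : A) (E : RegExp A L K)
  | cond (φ : L) (E₁ E₂ : RegExp A L K)
  | prob (p : Prob) (E₁ E₂ : RegExp A L K)
  | ndet (E₁ E₂ : RegExp A L K)
  | concat (z : K) (E₁ E₂ : RegExp A L K)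
  | closure (z : K) (E : RegExp A L K)

def leafTree {F K : Type} (l : Label F K) : PTree F K :=
  fun p => if p = [] then some l else none

def node1 {F K : Type} (f : F) (t : PTree F K) : PTree F K := fun p =>
  match p with
  | [] => some (Label.sym f)
  | 1 :: q => t q
  | _ => none

def node2 {F K : Type} (f : F) (t₁ t₂ : PTree F K) : PTree F K := fun p =>
  match p with
  | [] => some (Label.sym f)
  | 1 :: q => t₁ q
  | 2 :: q => t₂ q
  | _ => none

/-- The hyper-path interpretation `𝓣_K⟦E⟧`: `TreeOf E t` states that `t` is the
possibly-infinite tree denoted by the regular infinite-tree expression `E`.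
For closures, `t` is the `⊑_T`-least fixed point of substituting into the body. -/
inductive TreeOf {A L K : Type} : RegExp A L K → PTree (PSym A L) K → Prop where
  | eps : TreeOf RegExp.eps (leafTree (Label.sym PSym.eps))
  | var (z : K) : TreeOf (RegExp.var z) (leafTree (Label.var z))
  | seq (act : A) {E : RegExp A L K} {t : PTree (PSym A L) K} :
      TreeOf E t → TreeOf (RegExp.seq act E) (node1 (PSym.seq act) t)
  | cond (φ : L) {E₁ E₂ : RegExp A L K} {t₁ t₂ : PTree (PSym A L) K} :
      TreeOf E₁ t₁ → TreeOf E₂ t₂ →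
      TreeOf (RegExp.cond φ E₁ E₂) (node2 (PSym.cond φ) t₁ t₂)
  | prob (p : Prob) {E₁ E₂ : RegExp A L K} {t₁ t₂ : PTree (PSym A L) K} :
      TreeOf E₁ t₁ → TreeOf E₂ t₂ →
      TreeOf (RegExp.prob p E₁ E₂) (node2 (PSym.prob p) t₁ t₂)
  | ndet {E₁ E₂ : RegExp A L K} {t₁ t₂ : PTree (PSym A L) K} :
      TreeOf E₁ t₁ → TreeOf E₂ t₂ →
      TreeOf (RegExp.ndet E₁ E₂) (node2 PSym.ndet t₁ t₂)
  | concat (z : K) {E₁ E₂ : RegExp A L K} {t₁ t₂ : PTree (PSym A L) K} :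
      TreeOf E₁ t₁ → TreeOf E₂ t₂ →
      TreeOf (RegExp.concat z E₁ E₂) (subst z t₁ t₂)
  | closure (z : K) {E : RegExp A L K} {t' s : PTree (PSym A L) K} :
      TreeOf E t' → IsTree PSym.arity s →
      subst z t' s = s →
      (∀ u, IsTree PSym.arity u → subst z t' u = u → Refine PSym.arity s u) →
      TreeOf (RegExp.closure z E) s

/-- The algebraic interpretation `M_γ⟦E⟧` of a regular infinite-tree expression in a
Markov algebra; closures are interpreted as least fixed points (starting from `0`). -/
inductive MInterp {A L K M : Type} [PartialOrder M] [DecidableEq K]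
    (P : MarkovAlg L M) (ia : A → M) :
    RegExp A L K → (K → M) → M → Prop where
  | eps (γ : K → M) : MInterp P ia RegExp.eps γ P.one
  | var (γ : K → M) (z : K) : MInterp P ia (RegExp.var z) γ (γ z)
  | seq (act : A) {E : RegExp A L K} {γ : K → M} {v : M} :
      MInterp P ia E γ v → MInterp P ia (RegExp.seq act E) γ (P.mul (ia act) v)
  | cond (φ : L) {E₁ E₂ : RegExp A L K} {γ : K → M} {v₁ v₂ : M} :
      MInterp P ia E₁ γ v₁ → MInterp P ia E₂ γ v₂ →
      MInterp P ia (RegExp.cond φ E₁ E₂) γ (P.cond φ v₁ v₂)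
  | prob (p : Prob) {E₁ E₂ : RegExp A L K} {γ : K → M} {v₁ v₂ : M} :
      MInterp P ia E₁ γ v₁ → MInterp P ia E₂ γ v₂ →
      MInterp P ia (RegExp.prob p E₁ E₂) γ (P.prob p v₁ v₂)
  | ndet {E₁ E₂ : RegExp A L K} {γ : K → M} {v₁ v₂ : M} :
      MInterp P ia E₁ γ v₁ → MInterp P ia E₂ γ v₂ →
      MInterp P ia (RegExp.ndet E₁ E₂) γ (P.ndet v₁ v₂)
  | concat (z : K) {E₁ E₂ : RegExp A L K} {γ : K → M} {v₂ v : M} :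
      MInterp P ia E₂ γ v₂ → MInterp P ia E₁ (Function.update γ z v₂) v →
      MInterp P ia (RegExp.concat z E₁ E₂) γ v
  | closure (z : K) {E : RegExp A L K} {γ : K → M} (g : M → M) {v : M} :
      (∀ θ, MInterp P ia E (Function.update γ z θ) (g θ)) →
      g v = v → (∀ w, g w = w → v ≤ w) →
      MInterp P ia (RegExp.closure z E) γ v

/-! ### Trees -/

/-- A position labelled by the hole `z` has no proper extension that is also labelled by `z`. -/
def HoleLeaf {F K : Type} (z : K) (t : PTree F K) : Prop :=
  ∀ q r : Pos, t q = some (Label.var z) → t (q ++ r) = some (Label.var z) → r = []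

theorem HoleLeaf.subtree {F K : Type} {z : K} {t : PTree F K} (h : HoleLeaf z t) (p : Pos) :
    HoleLeaf z (subtree t p) := fun q r hq hr =>
  h (p ++ q) r hq (by simpa [_root_.subtree, List.append_assoc] using hr)

theorem IsTree.append_ne_none {F K : Type} {ar : F → ℕ} {t : PTree F K} (ht : IsTree ar t)
    (p r : Pos) (h : t (p ++ r) ≠ none) : t p ≠ none := by
  induction r using List.reverseRecOn with
  | nil => simpa using h
  | append_singleton r j ih => exact ih (ht.2.1 (p ++ r) j (by simpa using h))

theorem IsTree.holeLeaf {F K : Type} {ar : F → ℕ} {t : PTree F K} (ht : IsTree ar t) (z : K) :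
    HoleLeaf z t := by
  intro q r hq hr
  cases r with
  | nil => rfl
  | cons j r =>
    have h : t (q ++ [j]) ≠ none := ht.append_ne_none _ r (by simp [hr])
    have := (ht.2.2 q _ hq j).1 h
    simp only [Label.arity] at this
    omega

theorem IsTree.subtree {F K : Type} {ar : F → ℕ} {t : PTree F K} (ht : IsTree ar t)
    {l : Label F K} (hl : t [] = some l) {j : ℕ} (hj : 1 ≤ j) (hj' : j ≤ l.arity ar) :
    IsTree ar (subtree t [j]) := by
  refine ⟨(ht.2.2 [] l hl j).2 ⟨hj, hj'⟩, fun p i h => ?_, fun p l' h i => ?_⟩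
  · exact ht.2.1 ([j] ++ p) i (by simpa [_root_.subtree] using h)
  · simpa [_root_.subtree] using ht.2.2 ([j] ++ p) l' h i

theorem IsTree.cons_eq_none {F K : Type} {ar : F → ℕ} {t : PTree F K} (ht : IsTree ar t)
    {l : Label F K} (hl : t [] = some l) {j : ℕ} (hj : ¬(1 ≤ j ∧ j ≤ l.arity ar)) (q : Pos) :
    t (j :: q) = none := by
  by_contra h
  exact hj ((ht.2.2 [] l hl j).1 (ht.append_ne_none [j] q h))

/-- Coinduction principle for `IsTree`. -/
theorem IsTree.coinduct {F K : Type} {ar : F → ℕ} (S : PTree F K → Prop)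
    (hS : ∀ t, S t → ∃ l : Label F K, t [] = some l ∧
      (∀ j, 1 ≤ j → j ≤ l.arity ar → S (_root_.subtree t [j])) ∧
      ∀ j, ¬(1 ≤ j ∧ j ≤ l.arity ar) → ∀ q, t (j :: q) = none)
    {t : PTree F K} (ht : S t) : IsTree ar t := by
  refine ⟨?_, fun p => ?_, fun p => ?_⟩
  · obtain ⟨l, hl, -⟩ := hS t ht
    simp [hl]
  · induction p generalizing t with
    | nil =>
      obtain ⟨l, hl, -⟩ := hS t ht
      simp [hl]
    | cons i p ih =>
      intro j h
      obtain ⟨l, hl, hin, hout⟩ := hS t ht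
      by_cases hi : 1 ≤ i ∧ i ≤ l.arity ar
      · exact ih (hin i hi.1 hi.2) j h
      · exact absurd (hout i hi _) h
  · induction p generalizing t with
    | nil =>
      intro l' hl' j
      obtain ⟨l, hl, hin, hout⟩ := hS t ht
      obtain rfl : l = l' := by simpa [hl] using hl'
      by_cases hj : 1 ≤ j ∧ j ≤ l.arity ar
      · obtain ⟨m, hm, -⟩ := hS _ (hin j hj.1 hj.2)
        have hm' : t [j] = some m := hm
        simp [hm', hj]
      · simp [hout j hj, hj]
    | cons i p ih =>
      intro l' hl' j
      obtain ⟨l, hl, hin, hout⟩ := hS t ht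
      by_cases hi : 1 ≤ i ∧ i ≤ l.arity ar
      · exact ih (hin i hi.1 hi.2) l' hl' j
      · simp [hout i hi] at hl'

theorem IsTree.exists_root {F K : Type} {ar : F → ℕ} {t : PTree F K} (ht : IsTree ar t) :
    ∃ l, t [] = some l := Option.ne_none_iff_exists'.1 ht.1

theorem isTree_of_root {F K : Type} {ar : F → ℕ} {t : PTree F K} {l : Label F K}
    (hl : t [] = some l)
    (hin : ∀ j, 1 ≤ j → j ≤ l.arity ar → IsTree ar (subtree t [j]))
    (hout : ∀ j, ¬(1 ≤ j ∧ j ≤ l.arity ar) → ∀ q, t (j :: q) = none) : IsTree ar t := by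
  refine IsTree.coinduct (fun s => s = t ∨ IsTree ar s) ?_ (Or.inl rfl)
  rintro s (rfl | hs)
  · exact ⟨l, hl, fun j h h' => Or.inr (hin j h h'), hout⟩
  · obtain ⟨m, hm⟩ := hs.exists_root
    exact ⟨m, hm, fun j h h' => Or.inr (hs.subtree hm h h'), fun j h => hs.cons_eq_none hm h⟩

theorem IsTree.eq_loopTree {F K : Type} {ar : F → ℕ} {t : PTree F K} (ht : IsTree ar t)
    (hl : t [] = some Label.loop) : t = loopTree := by
  funext p
  cases p with
  | nil => simp [loopTree, hl]
  | cons j q =>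
    rw [ht.cons_eq_none hl (by simp only [Label.arity]; omega)]
    simp [loopTree]

theorem isTree_leafTree {F K : Type} {ar : F → ℕ} {l : Label F K} (hl : l.arity ar = 0) :
    IsTree ar (leafTree l) :=
  isTree_of_root (l := l) (by simp [leafTree]) (fun j h h' => by omega)
    (fun j _ q => by simp [leafTree])

theorem isTree_node1 {F K : Type} {ar : F → ℕ} {f : F} {t : PTree F K} (hf : ar f = 1)
    (ht : IsTree ar t) : IsTree ar (node1 f t) := by
  refine isTree_of_root (l := .sym f) rfl (fun j h h' => ?_) (fun j h q => ?_)
  · obtain rfl : j = 1 := by simp only [Label.arity] at h'; omega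
    exact ht
  · simp only [Label.arity] at h
    unfold node1
    split
    · simp_all
    · simp_all
    · rfl

theorem isTree_node2 {F K : Type} {ar : F → ℕ} {f : F} {t₁ t₂ : PTree F K} (hf : ar f = 2)
    (ht₁ : IsTree ar t₁) (ht₂ : IsTree ar t₂) : IsTree ar (node2 f t₁ t₂) := by
  refine isTree_of_root (l := .sym f) rfl (fun j h h' => ?_) (fun j h q => ?_)
  · obtain rfl | rfl : j = 1 ∨ j = 2 := by simp only [Label.arity] at h'; omega
    · exact ht₁
    · exact ht₂
  · simp only [Label.arity] at h
    unfold node2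
    split
    · simp_all
    · simp_all
    · simp_all
    · rfl

/-! ### Substitution -/

section Subst

variable {F K : Type} {z : K}

theorem subst_apply_of_hole {t u : PTree F K} (ht : HoleLeaf z t) {p q : Pos} (hqp : q <+: p)
    (hq : t q = some (Label.var z)) : subst z t u p = u (p.drop q.length) := by
  have h : ∃ q : Pos, q <+: p ∧ t q = some (Label.var z) := ⟨q, hqp, hq⟩
  have key : h.choose = q := by
    obtain ⟨h₁, h₂⟩ := h.choose_spec
    rcases List.prefix_or_prefix_of_prefix h₁ hqp with ⟨r, hr⟩ | ⟨r, hr⟩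
    · have hr₀ := ht _ r h₂ (by rw [hr]; exact hq)
      rw [← hr, hr₀, List.append_nil]
    · have hr₀ := ht _ r hq (by rw [hr]; exact h₂)
      rw [← hr, hr₀, List.append_nil]
  rw [subst, dif_pos h, key]

theorem subst_apply_of_no_hole {t u : PTree F K} {p : Pos}
    (h : ¬∃ q : Pos, q <+: p ∧ t q = some (Label.var z)) : subst z t u p = t p := by
  rw [subst, dif_neg h]

theorem subst_of_root_eq {t : PTree F K} (ht : HoleLeaf z t) (h : t [] = some (Label.var z))
    (u : PTree F K) : subst z t u = u := by
  funext p
  simpa using subst_apply_of_hole (u := u) ht (List.nil_prefix (l := p)) h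

theorem subst_root {t : PTree F K} (h : t [] ≠ some (Label.var z)) (u : PTree F K) :
    subst z t u [] = t [] := by
  refine subst_apply_of_no_hole ?_
  rintro ⟨q, hq, hz⟩
  rw [List.prefix_nil.1 hq] at hz
  exact h hz

theorem subtree_subst {t : PTree F K} (ht : HoleLeaf z t) (h : t [] ≠ some (Label.var z))
    (u : PTree F K) (i : ℕ) : subtree (subst z t u) [i] = subst z (subtree t [i]) u := by
  funext p
  change subst z t u (i :: p) = _
  by_cases hp : ∃ q : Pos, q <+: p ∧ subtree t [i] q = some (Label.var z)
  · obtain ⟨q, hq, hz⟩ := hp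
    rw [subst_apply_of_hole (ht.subtree [i]) hq hz,
      subst_apply_of_hole (q := i :: q) ht (by simpa using hq) hz]
    simp
  · rw [subst_apply_of_no_hole hp, subst_apply_of_no_hole]
    · rfl
    rintro ⟨q, hq, hz⟩
    cases q with
    | nil => exact h hz
    | cons j q =>
      obtain ⟨rfl, hqp⟩ := List.cons_prefix_cons.1 hq
      exact hp ⟨q, hqp, hz⟩

theorem subst_cons_eq_none {t : PTree F K} (h : t [] ≠ some (Label.var z)) {j : ℕ}
    (hnone : ∀ q, t (j :: q) = none) (u : PTree F K) (q : Pos) : subst z t u (j :: q) = none := by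
  rw [subst_apply_of_no_hole, hnone]
  rintro ⟨q', hq', hz⟩
  cases q' with
  | nil => exact h hz
  | cons k q' =>
    obtain ⟨rfl, -⟩ := List.cons_prefix_cons.1 hq'
    simp [hnone] at hz

theorem isTree_subst {ar : F → ℕ} {t u : PTree F K} (ht : IsTree ar t) (hu : IsTree ar u) :
    IsTree ar (subst z t u) := by
  refine IsTree.coinduct (fun s => IsTree ar s ∨ ∃ t, IsTree ar t ∧ s = subst z t u) ?_
    (Or.inr ⟨t, ht, rfl⟩)
  have key : ∀ s, IsTree ar s → ∃ l : Label F K, s [] = some l ∧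
      (∀ j, 1 ≤ j → j ≤ l.arity ar →
        (IsTree ar (subtree s [j]) ∨ ∃ t, IsTree ar t ∧ subtree s [j] = subst z t u)) ∧
      ∀ j, ¬(1 ≤ j ∧ j ≤ l.arity ar) → ∀ q, s (j :: q) = none := fun s hs => by
    obtain ⟨l, hl⟩ := hs.exists_root
    exact ⟨l, hl, fun j h h' => Or.inl (hs.subtree hl h h'), fun j h => hs.cons_eq_none hl h⟩
  rintro s (hs | ⟨t, ht, rfl⟩)
  · exact key s hs
  by_cases hr : t [] = some (Label.var z)
  · rw [subst_of_root_eq (ht.holeLeaf z) hr]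
    exact key u hu
  · obtain ⟨l, hl⟩ := ht.exists_root
    refine ⟨l, by rw [subst_root hr, hl],
      fun j h h' => Or.inr ⟨_, ht.subtree hl h h', subtree_subst (ht.holeLeaf z) hr u j⟩,
      fun j h q => subst_cons_eq_none hr (ht.cons_eq_none hl h) u q⟩

open Classical in
/-- The solution of `s = subst z t s` for a tree `t` whose root is not the hole `z`. -/
noncomputable def substFix (z : K) (t : PTree F K) : PTree F K := fun p =>
  if h : ∃ q : Pos, q <+: p ∧ t q = some (Label.var z) then
    if _h₀ : h.choose = [] then none else substFix z t (p.drop h.choose.length)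
  else t p
termination_by p => p.length
decreasing_by
  have h₁ := h.choose_spec.1.length_le
  have h₂ := List.length_pos_iff.2 _h₀
  rw [List.length_drop]
  omega

theorem subst_substFix {t : PTree F K} (h : t [] ≠ some (Label.var z)) :
    subst z t (substFix z t) = substFix z t := by
  funext p
  rw [substFix, subst]
  by_cases hp : ∃ q : Pos, q <+: p ∧ t q = some (Label.var z)
  · have h₀ : hp.choose ≠ [] := fun h₀ => h (h₀ ▸ hp.choose_spec.2)
    rw [dif_pos hp, dif_pos hp, dif_neg h₀]
  · rw [dif_neg hp, dif_neg hp]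

/-- Substituting a solution `u` of `u = subst z t u` into any tree can be rewritten as
substituting it into a tree whose root is not the hole. -/
theorem exists_subst_guarded {ar : F → ℕ} {t t' : PTree F K} (ht : IsTree ar t)
    (ht' : IsTree ar t') (hr : t [] ≠ some (Label.var z)) :
    ∃ t₀, IsTree ar t₀ ∧ t₀ [] ≠ some (Label.var z) ∧
      ∀ u, subst z t u = u → subst z t' u = subst z t₀ u := by
  by_cases h : t' [] = some (Label.var z)
  · exact ⟨t, ht, hr, fun u hu => by rw [subst_of_root_eq (ht'.holeLeaf z) h, hu]⟩
  · exact ⟨t', ht', h, fun _ _ => rfl⟩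

theorem isTree_substFix {ar : F → ℕ} {t : PTree F K} (ht : IsTree ar t)
    (hr : t [] ≠ some (Label.var z)) : IsTree ar (substFix z t) := by
  refine IsTree.coinduct (fun s => ∃ t', IsTree ar t' ∧ s = subst z t' (substFix z t)) ?_
    ⟨t, ht, (subst_substFix hr).symm⟩
  rintro s ⟨t', ht', rfl⟩
  obtain ⟨t₀, ht₀, hr₀, h₀⟩ := exists_subst_guarded ht ht' hr
  rw [h₀ _ (subst_substFix hr)]
  obtain ⟨l, hl⟩ := ht₀.exists_root
  refine ⟨l, by rw [subst_root hr₀, hl],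
    fun j h h' => ⟨_, ht₀.subtree hl h h', subtree_subst (ht₀.holeLeaf z) hr₀ _ j⟩,
    fun j h q => subst_cons_eq_none hr₀ (ht₀.cons_eq_none hl h) _ q⟩

theorem refine_substFix {ar : F → ℕ} {t u : PTree F K} (ht : IsTree ar t)
    (hr : t [] ≠ some (Label.var z)) (hu : subst z t u = u) :
    Refine ar (substFix z t) u := by
  refine ⟨fun a b => ∃ t', IsTree ar t' ∧ a = subst z t' (substFix z t) ∧ b = subst z t' u,
    ?_, t, ht, (subst_substFix hr).symm, hu.symm⟩
  rintro a b ⟨t', ht', rfl, rfl⟩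
  obtain ⟨t₀, ht₀, hr₀, h₀⟩ := exists_subst_guarded ht ht' hr
  rw [h₀ _ (subst_substFix hr), h₀ _ hu]
  obtain ⟨l, hl⟩ := ht₀.exists_root
  by_cases hloop : l = Label.loop
  · left
    refine (isTree_subst ht₀ (isTree_substFix ht hr)).eq_loopTree ?_
    rw [subst_root hr₀, hl, hloop]
  · refine Or.inr ⟨l, hloop, by rw [subst_root hr₀, hl], by rw [subst_root hr₀, hl],
      fun i h h' => ⟨_, ht₀.subtree hl h h', ?_, ?_⟩⟩ <;>
    exact subtree_subst (ht₀.holeLeaf z) hr₀ _ i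

theorem refine_loopTree {ar : F → ℕ} (u : PTree F K) : Refine ar loopTree u :=
  ⟨fun a _ => a = loopTree, fun _ _ h => Or.inl h, rfl⟩

theorem eq_loopTree_of_refine {ar : F → ℕ} {s : PTree F K} (h : Refine ar s loopTree) :
    s = loopTree := by
  obtain ⟨R, hR, hs⟩ := h
  rcases hR _ _ hs with h | ⟨l, hl, -, h, -⟩
  · exact h
  · simp only [loopTree, if_true, Option.some.injEq] at h
    exact absurd h.symm hl

end Subst

/-! ### The tree denoted by an expression -/

theorem TreeOf.isTree {A L K : Type} {E : RegExp A L K} {t : PTree (PSym A L) K}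
    (h : TreeOf E t) : IsTree PSym.arity t := by
  induction h with
  | eps => exact isTree_leafTree rfl
  | var z => exact isTree_leafTree rfl
  | seq act _ ih => exact isTree_node1 rfl ih
  | cond φ _ _ ih₁ ih₂ => exact isTree_node2 rfl ih₁ ih₂
  | prob p _ _ ih₁ ih₂ => exact isTree_node2 rfl ih₁ ih₂
  | ndet _ _ ih₁ ih₂ => exact isTree_node2 rfl ih₁ ih₂
  | concat z _ _ ih₁ ih₂ => exact isTree_subst ih₁ ih₂
  | closure z _ hs _ _ _ => exact hs

theorem exists_treeOf {A L K : Type} (E : RegExp A L K) : ∃ t, TreeOf E t := by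
  induction E with
  | eps => exact ⟨_, .eps⟩
  | var z => exact ⟨_, .var z⟩
  | seq act E ih => exact ih.imp' _ fun _ h => .seq act h
  | cond φ E₁ E₂ ih₁ ih₂ =>
    obtain ⟨⟨t₁, h₁⟩, t₂, h₂⟩ := And.intro ih₁ ih₂
    exact ⟨_, .cond φ h₁ h₂⟩
  | prob p E₁ E₂ ih₁ ih₂ =>
    obtain ⟨⟨t₁, h₁⟩, t₂, h₂⟩ := And.intro ih₁ ih₂
    exact ⟨_, .prob p h₁ h₂⟩
  | ndet E₁ E₂ ih₁ ih₂ =>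
    obtain ⟨⟨t₁, h₁⟩, t₂, h₂⟩ := And.intro ih₁ ih₂
    exact ⟨_, .ndet h₁ h₂⟩
  | concat z E₁ E₂ ih₁ ih₂ =>
    obtain ⟨⟨t₁, h₁⟩, t₂, h₂⟩ := And.intro ih₁ ih₂
    exact ⟨_, .concat z h₁ h₂⟩
  | closure z E ih =>
    obtain ⟨t, h⟩ := ih
    by_cases hr : t [] = some (Label.var z)
    · exact ⟨loopTree, .closure z h (isTree_leafTree (l := .loop) rfl)
        (subst_of_root_eq (h.isTree.holeLeaf z) hr _) fun u _ _ => refine_loopTree u⟩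
    · exact ⟨substFix z t, .closure z h (isTree_substFix h.isTree hr) (subst_substFix hr)
        fun u _ hu => refine_substFix h.isTree hr hu⟩

/-! ### Evaluating trees in a Markov algebra -/

section Eval

variable {A L K M : Type} [PartialOrder M] (P : MarkovAlg L M) (ia : A → M)

/-- The operation of the algebra attached to a program symbol; symbols of arity less than two
ignore the superfluous arguments. -/
def MarkovAlg.symOp : PSym A L → M → M → M
  | .eps, _, _ => P.one
  | .seq act, x, _ => P.mul (ia act) x
  | .cond φ, x, y => P.cond φ x y
  | .prob p, x, y => P.prob p x y
  | .ndet, x, y => P.ndet x y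

theorem MarkovAlg.symOp_scott_left (f : PSym A L) (y : M) :
    ScottContinuous fun x => P.symOp ia f x y := by
  cases f with
  | eps => exact .const _
  | seq act => exact P.mul_scott_right _
  | cond φ => exact P.cond_scott_left φ y
  | prob p => exact P.prob_scott_left p y
  | ndet => exact P.ndet_scott_left y

theorem MarkovAlg.symOp_scott_right (f : PSym A L) (x : M) :
    ScottContinuous (P.symOp ia f x) := by
  cases f with
  | eps => exact .const _
  | seq act => exact .const _
  | cond φ => exact P.cond_scott_right φ x
  | prob p => exact P.prob_scott_right p x
  | ndet => exact P.ndet_scott_right x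

theorem MarkovAlg.symOp_mono (f : PSym A L) {x x' y y' : M} (hx : x ≤ x') (hy : y ≤ y') :
    P.symOp ia f x y ≤ P.symOp ia f x' y' :=
  ((P.symOp_scott_left ia f y).monotone hx).trans ((P.symOp_scott_right ia f x').monotone hy)

theorem directedOn_range_of_monotone {a : ℕ → M} (ha : Monotone a) :
    DirectedOn (· ≤ ·) (Set.range a) :=
  directedOn_range.2 ha.directed_le

theorem MarkovAlg.isLUB_symOp (f : PSym A L) {a b : ℕ → M} (ha : Monotone a) (hb : Monotone b)
    {x y : M} (hx : IsLUB (Set.range a) x) (hy : IsLUB (Set.range b) y) :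
    IsLUB (Set.range fun i => P.symOp ia f (a i) (b i)) (P.symOp ia f x y) := by
  constructor
  · rintro _ ⟨i, rfl⟩
    exact P.symOp_mono ia f (hx.1 ⟨i, rfl⟩) (hy.1 ⟨i, rfl⟩)
  · intro c hc
    refine (P.symOp_scott_left ia f y (Set.range_nonempty a)
      (directedOn_range_of_monotone ha) hx).2 ?_
    rintro _ ⟨_, ⟨i, rfl⟩, rfl⟩
    refine (P.symOp_scott_right ia f (a i) (Set.range_nonempty b)
      (directedOn_range_of_monotone hb) hy).2 ?_
    rintro _ ⟨_, ⟨j, rfl⟩, rfl⟩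
    exact (P.symOp_mono ia f (ha (le_max_left i j)) (hb (le_max_right i j))).trans
      (hc ⟨max i j, rfl⟩)

variable {P ia} {γ : K → M} {t : PTree (PSym A L) K}

theorem maSeq_succ_sym {f : PSym A L} (h : t [] = some (.sym f)) (i : ℕ) :
    maSeq P ia γ (i + 1) t =
      P.symOp ia f (maSeq P ia γ i (subtree t [1])) (maSeq P ia γ i (subtree t [2])) := by
  cases f <;> simp [maSeq, h, MarkovAlg.symOp]

theorem maSeq_succ_var {k : K} (h : t [] = some (.var k)) (i : ℕ) :
    maSeq P ia γ (i + 1) t = γ k := by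
  simp [maSeq, h]

theorem maSeq_succ_loop (h : t [] = some .loop) (i : ℕ) : maSeq P ia γ (i + 1) t = P.bot := by
  simp [maSeq, h]

theorem maSeq_succ_none (h : t [] = none) (i : ℕ) : maSeq P ia γ (i + 1) t = P.bot := by
  simp [maSeq, h]

theorem maSeq_mono {γ' : K → M} (hγ : γ ≤ γ') {n m : ℕ} (hnm : n ≤ m)
    (t : PTree (PSym A L) K) : maSeq P ia γ n t ≤ maSeq P ia γ' m t := by
  induction n generalizing m t with
  | zero => exact P.bot_le _
  | succ n ih =>
    obtain ⟨m, rfl⟩ := Nat.exists_eq_add_one_of_ne_zero (show m ≠ 0 by omega)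
    have hnm' : n ≤ m := by omega
    match h : t [] with
    | none => exact (maSeq_succ_none h n).trans_le (P.bot_le _)
    | some .loop => exact (maSeq_succ_loop h n).trans_le (P.bot_le _)
    | some (.var k) => rw [maSeq_succ_var h, maSeq_succ_var h]; exact hγ k
    | some (.sym f) =>
      rw [maSeq_succ_sym h, maSeq_succ_sym h]
      exact P.symOp_mono ia f (ih hnm' _) (ih hnm' _)

variable (P ia γ t) in
theorem monotone_maSeq : Monotone fun n => maSeq P ia γ n t :=
  fun _ _ h => maSeq_mono le_rfl h t

variable (P ia γ t) in
theorem exists_isLUB_maSeq : ∃ v, IsLUB (Set.range fun n => maSeq P ia γ n t) v :=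
  P.dcpo _ (Set.range_nonempty _) (directedOn_range_of_monotone (monotone_maSeq P ia γ t))

theorem isLUB_maSeq_of_succ {v : M} (h : ∀ n, maSeq P ia γ (n + 1) t = v) :
    IsLUB (Set.range fun n => maSeq P ia γ n t) v := by
  refine ⟨?_, fun c hc => h 0 ▸ hc ⟨1, rfl⟩⟩
  rintro _ ⟨n, rfl⟩
  cases n with
  | zero => exact P.bot_le _
  | succ n => exact (h n).le

theorem isLUB_maSeq_sym {f : PSym A L} (h : t [] = some (.sym f)) {x y : M}
    (hx : IsLUB (Set.range fun n => maSeq P ia γ n (subtree t [1])) x)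
    (hy : IsLUB (Set.range fun n => maSeq P ia γ n (subtree t [2])) y) :
    IsLUB (Set.range fun n => maSeq P ia γ n t) (P.symOp ia f x y) := by
  have key := P.isLUB_symOp ia f (monotone_maSeq ..) (monotone_maSeq ..) hx hy
  simp only [← maSeq_succ_sym h] at key
  constructor
  · rintro _ ⟨n, rfl⟩
    exact (maSeq_mono le_rfl n.le_succ t).trans (key.1 ⟨n, rfl⟩)
  · intro c hc
    refine key.2 ?_
    rintro _ ⟨n, rfl⟩
    exact hc ⟨n + 1, rfl⟩

variable [DecidableEq K] {z : K} {u : PTree (PSym A L) K}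

theorem maSeq_succ_subst_le_of_guarded (ht : HoleLeaf z t) (hr : t [] ≠ some (.var z)) {θ : M}
    {n : ℕ} (ih : ∀ t, HoleLeaf z t →
      maSeq P ia γ n (subst z t u) ≤ maSeq P ia (Function.update γ z θ) n t) :
    maSeq P ia γ (n + 1) (subst z t u) ≤ maSeq P ia (Function.update γ z θ) (n + 1) t := by
  match h : t [] with
  | none => exact (maSeq_succ_none (by rw [subst_root hr, h]) n).trans_le (P.bot_le _)
  | some .loop => exact (maSeq_succ_loop (by rw [subst_root hr, h]) n).trans_le (P.bot_le _)
  | some (.var k) =>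
    have hk : k ≠ z := by rintro rfl; exact hr h
    rw [maSeq_succ_var (k := k) (by rw [subst_root hr, h]), maSeq_succ_var h,
      Function.update_of_ne hk]
  | some (.sym f) =>
    rw [maSeq_succ_sym (f := f) (by rw [subst_root hr, h]), maSeq_succ_sym h,
      subtree_subst ht hr, subtree_subst ht hr]
    exact P.symOp_mono ia f (ih _ (ht.subtree _)) (ih _ (ht.subtree _))

theorem maSeq_subst_le {θ : M} {n : ℕ} (hu : maSeq P ia γ n u ≤ θ) (ht : HoleLeaf z t) :
    maSeq P ia γ n (subst z t u) ≤ maSeq P ia (Function.update γ z θ) n t := by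
  induction n generalizing t with
  | zero => exact P.bot_le _
  | succ n ih =>
    by_cases hr : t [] = some (.var z)
    · rw [subst_of_root_eq ht hr, maSeq_succ_var hr, Function.update_self]
      exact hu
    · exact maSeq_succ_subst_le_of_guarded ht hr fun _ ht =>
        ih ((maSeq_mono le_rfl n.le_succ u).trans hu) ht

theorem maSeq_update_le_of_isLUB {θ v : M}
    (hθ : IsLUB (Set.range fun n => maSeq P ia γ n u) θ) (ht : HoleLeaf z t)
    (hv : IsLUB (Set.range fun n => maSeq P ia γ n (subst z t u)) v) (n : ℕ) :
    maSeq P ia (Function.update γ z θ) n t ≤ v := by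
  induction n generalizing t v with
  | zero => exact P.bot_le _
  | succ n ih =>
    by_cases hr : t [] = some (.var z)
    · rw [subst_of_root_eq ht hr] at hv
      rw [maSeq_succ_var hr, Function.update_self, hθ.unique hv]
    match h : t [] with
    | none => exact (maSeq_succ_none h n).trans_le (P.bot_le _)
    | some .loop => exact (maSeq_succ_loop h n).trans_le (P.bot_le _)
    | some (.var k) =>
      have hk : k ≠ z := by rintro rfl; exact hr h
      rw [maSeq_succ_var h, Function.update_of_ne hk,
        ← maSeq_succ_var (P := P) (ia := ia) (γ := γ) (t := subst z t u)
          (by rw [subst_root hr, h]) 0]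
      exact hv.1 ⟨1, rfl⟩
    | some (.sym f) =>
      obtain ⟨x, hx⟩ := exists_isLUB_maSeq P ia γ (subst z (subtree t [1]) u)
      obtain ⟨y, hy⟩ := exists_isLUB_maSeq P ia γ (subst z (subtree t [2]) u)
      have hxy := isLUB_maSeq_sym (t := subst z t u) (f := f) (by rw [subst_root hr, h])
        (by rwa [subtree_subst ht hr]) (by rwa [subtree_subst ht hr])
      rw [maSeq_succ_sym h, hv.unique hxy]
      exact P.symOp_mono ia f (ih (ht.subtree _) hx) (ih (ht.subtree _) hy)

theorem isLUB_maSeq_subst {θ v : M} (hθ : IsLUB (Set.range fun n => maSeq P ia γ n u) θ)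
    (ht : HoleLeaf z t)
    (hv : IsLUB (Set.range fun n => maSeq P ia (Function.update γ z θ) n t) v) :
    IsLUB (Set.range fun n => maSeq P ia γ n (subst z t u)) v := by
  constructor
  · rintro _ ⟨n, rfl⟩
    exact (maSeq_subst_le (hθ.1 ⟨n, rfl⟩) ht).trans (hv.1 ⟨n, rfl⟩)
  · intro c hc
    obtain ⟨w, hw⟩ := exists_isLUB_maSeq P ia γ (subst z t u)
    refine le_trans (hv.2 ?_) (hw.2 hc)
    rintro _ ⟨n, rfl⟩
    exact maSeq_update_le_of_isLUB hθ ht hw n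

theorem maSeq_le_of_subst_eq (ht : HoleLeaf z t) (hr : t [] ≠ some (.var z))
    (hu : subst z t u = u) {v : M}
    (hv : IsLUB (Set.range fun n => maSeq P ia (Function.update γ z v) n t) v) (n : ℕ) :
    maSeq P ia γ n u ≤ v := by
  induction n with
  | zero => exact P.bot_le _
  | succ n ih =>
    rw [← hu]
    exact (maSeq_succ_subst_le_of_guarded ht hr fun _ ht => maSeq_subst_le ih ht).trans
      (hv.1 ⟨n + 1, rfl⟩)

/-- The algebraic interpretation of an expression is the value of the tree it denotes. -/
theorem MInterp.isLUB_maSeq {E : RegExp A L K} {v : M} (hE : MInterp P ia E γ v)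
    (ht : TreeOf E t) : IsLUB (Set.range fun n => maSeq P ia γ n t) v := by
  induction hE generalizing t with
  | eps γ =>
    cases ht
    exact isLUB_maSeq_of_succ fun n => maSeq_succ_sym (f := .eps) (by simp [leafTree]) n
  | var γ z =>
    cases ht
    exact isLUB_maSeq_of_succ fun n => maSeq_succ_var (by simp [leafTree]) n
  | @seq act E γ v _ ih =>
    cases ht with
    | @seq _ _ t ht =>
      exact isLUB_maSeq_sym (f := .seq act) rfl (ih ht) (exists_isLUB_maSeq ..).choose_spec
  | cond φ _ _ ih₁ ih₂ =>
    cases ht with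
    | cond _ h₁ h₂ => exact isLUB_maSeq_sym (f := .cond φ) rfl (ih₁ h₁) (ih₂ h₂)
  | prob p _ _ ih₁ ih₂ =>
    cases ht with
    | prob _ h₁ h₂ => exact isLUB_maSeq_sym (f := .prob p) rfl (ih₁ h₁) (ih₂ h₂)
  | ndet _ _ ih₁ ih₂ =>
    cases ht with
    | ndet h₁ h₂ => exact isLUB_maSeq_sym (f := .ndet) rfl (ih₁ h₁) (ih₂ h₂)
  | concat z _ _ ih₂ ih₁ =>
    cases ht with
    | concat _ h₁ h₂ => exact isLUB_maSeq_subst (ih₂ h₂) (h₁.isTree.holeLeaf z) (ih₁ h₁)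
  | @closure z E γ g v _ hfix hleast ih =>
    cases ht with
    | @closure _ _ body _ ht _ hsubst hmin =>
      have hleaf := ht.isTree.holeLeaf z
      by_cases hr : body [] = some (.var z)
      · have hg : g P.bot = P.bot :=
          (ih P.bot ht).unique (isLUB_maSeq_of_succ fun n => by
            rw [maSeq_succ_var hr, Function.update_self])
        rw [le_antisymm (hleast _ hg) (P.bot_le v),
          eq_loopTree_of_refine (hmin loopTree (isTree_leafTree (l := .loop) rfl)
            (subst_of_root_eq hleaf hr _))]
        exact isLUB_maSeq_of_succ fun n => maSeq_succ_loop (by simp [loopTree]) n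
      · obtain ⟨w, hw⟩ := exists_isLUB_maSeq P ia γ t
        have hgw := isLUB_maSeq_subst hw hleaf (ih w ht)
        rw [hsubst] at hgw
        have hvw : v ≤ w := hleast w (hgw.unique hw)
        have hv := ih v ht
        rw [hfix] at hv
        have hwv : w ≤ v := hw.2 <| by
          rintro _ ⟨n, rfl⟩
          exact maSeq_le_of_subst_eq hleaf hr hsubst hv n
        rwa [le_antisymm hvw hwv]

end Eval

/-- Hyper-path interpretation is sound for Markov-algebra interpretation: if two regular
infinite-tree expressions have the same hyper-path interpretation `𝓣_K⟦E⟧ = 𝓣_K⟦F⟧`,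
then for every Markov-algebra interpretation and every hole-valuation `γ`, their
algebraic interpretations agree: `M_γ⟦E⟧ = M_γ⟦F⟧`. -/
theorem treeInterp_eq_implies_algInterp_eq {A L K : Type}
    (E F : RegExp A L K)
    (hEF : ∀ t : PTree (PSym A L) K, TreeOf E t ↔ TreeOf F t) :
    ∀ (M : Type) [PartialOrder M] [DecidableEq K]
      (P : MarkovAlg L M) (ia : A → M) (γ : K → M) (v w : M),
      MInterp P ia E γ v → MInterp P ia F γ w → v = w := by
  intro M _ _ P ia γ v w hv hw
  obtain ⟨t, ht⟩ := exists_treeOf E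
  exact (hv.isLUB_maSeq ht).unique (hw.isLUB_maSeq ((hEF t).1 ht))
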